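/- Let Ω ⊂ ℍⁿ be a bounded open set with C¹ boundary that is strictly starshaped with respect to the origin, and suppose Ω satisfies the exterior gauge ball property at a point z ∈ ∂Ω, with exterior tangent gauge ball B_ρ(z₁,R) (so B_ρ(z₁,R) ⊂ ℍⁿ∖closure(Ω) and closure(B_ρ(z₁,R)) ∩ ∂Ω = {z}). Then there exists λ̄ > 0 such that δ_λ(z) ∈ B_ρ(z₁,R) for every λ with 0 < λ ≤ λ̄. -/

import Mathlib

open MeasureTheory Real Set

noncomputable section

/-- The underlying space of the Heisenberg group `ℍⁿ`, i.e. `ℝ^(2n+1)`,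
with coordinates `(x₁, …, xₙ, y₁, …, yₙ, t)`. -/
abbrev Heis (n : ℕ) := Fin (2 * n + 1) → ℝ

namespace Heis

variable {n : ℕ}

/-- The index of the coordinate `xᵢ`. -/
def xIdx (n : ℕ) (i : Fin n) : Fin (2 * n + 1) := ⟨(i : ℕ), by have := i.isLt; omega⟩

/-- The index of the coordinate `yᵢ`. -/
def yIdx (n : ℕ) (i : Fin n) : Fin (2 * n + 1) := ⟨n + (i : ℕ), by have := i.isLt; omega⟩

/-- The index of the coordinate `t`. -/
def tIdx (n : ℕ) : Fin (2 * n + 1) := ⟨2 * n, by omega⟩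

/-- The Heisenberg group product. -/
def mul (z w : Heis n) : Heis n := fun k =>
  if (k : ℕ) = 2 * n then
    z k + w k + 2 * ∑ i : Fin n,
      (w (xIdx n i) * z (yIdx n i) - z (xIdx n i) * w (yIdx n i))
  else z k + w k

/-- The Heisenberg group inverse. -/
def inv (z : Heis n) : Heis n := fun k => - z k

/-- The Koranyi gauge `ρ`. -/
def rho (z : Heis n) : ℝ :=
  ((∑ i : Fin n, (z (xIdx n i) ^ 2 + z (yIdx n i) ^ 2)) ^ 2 + z (tIdx n) ^ 2) ^ ((1 : ℝ) / 4)

/-- The gauge ball `B_ρ(z, R) = {w | ρ(w⁻¹ ⬝ z) < R}`. -/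
def gaugeBall (z : Heis n) (R : ℝ) : Set (Heis n) := {w | rho (mul (inv w) z) < R}

/-- The anisotropic dilations `δ_λ`. -/
def dil (lam : ℝ) (z : Heis n) : Heis n := fun k =>
  if (k : ℕ) = 2 * n then Real.exp (2 * lam) * z k else Real.exp lam * z k

/-- The dilation-generating vector field `Z(z) = (x₁, …, xₙ, y₁, …, yₙ, 2t)`. -/
def Zvf (z : Heis n) : Heis n := fun k => if (k : ℕ) = 2 * n then 2 * z k else z k

/-- The Euclidean scalar product of `ℝ^(2n+1)`. -/
def einner (v w : Heis n) : ℝ := ∑ k, v k * w k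

/-- The Euclidean norm of `ℝ^(2n+1)`. -/
def euclNorm (v : Heis n) : ℝ := Real.sqrt (∑ k, v k ^ 2)

/-- The Euclidean gradient of `f`, via the Fréchet derivative. -/
def grad (f : Heis n → ℝ) (z : Heis n) : Heis n := fun k => fderiv ℝ f z (Pi.single k 1)

/-- The horizontal derivative `Xᵢ f = ∂f/∂xᵢ + 2 yᵢ ∂f/∂t`. -/
def Xd (i : Fin n) (f : Heis n → ℝ) (z : Heis n) : ℝ :=
  grad f z (xIdx n i) + 2 * z (yIdx n i) * grad f z (tIdx n)

/-- The horizontal derivative `Yⱼ f = ∂f/∂yⱼ − 2 xⱼ ∂f/∂t`. -/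
def Yd (i : Fin n) (f : Heis n → ℝ) (z : Heis n) : ℝ :=
  grad f z (yIdx n i) - 2 * z (xIdx n i) * grad f z (tIdx n)

/-- The horizontal gradient `∇_ℍ f = (X₁ f, …, Xₙ f, Y₁ f, …, Yₙ f)`. -/
def hGrad (f : Heis n → ℝ) (z : Heis n) : (Fin n → ℝ) × (Fin n → ℝ) :=
  (fun i => Xd i f z, fun i => Yd i f z)

/-- The norm `|∇_ℍ f|` of the horizontal gradient. -/
def hNorm (f : Heis n → ℝ) (z : Heis n) : ℝ :=
  Real.sqrt (∑ i : Fin n, ((Xd i f z) ^ 2 + (Yd i f z) ^ 2))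

/-- `f` is weakly horizontally `p`-harmonic on the open set `U` :
`f` and `∇_ℍ f` are locally `p`-integrable on `U` and
`∫_U |∇_ℍ f|^(p−2) ⟨∇_ℍ f, ∇_ℍ φ⟩ = 0` for every `C¹` function `φ`
with compact support contained in `U` (note that `Real.rpow` makes the
integrand vanish at points where `∇_ℍ f = 0`). -/
def PHarmonicOn (p : ℝ) (f : Heis n → ℝ) (U : Set (Heis n)) : Prop :=
  LocallyIntegrableOn (fun z => |f z| ^ p) U volume ∧
  LocallyIntegrableOn (fun z => hNorm f z ^ p) U volume ∧
  ∀ φ : Heis n → ℝ, ContDiff ℝ 1 φ → HasCompactSupport φ → tsupport φ ⊆ U →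
    ∫ z in U, hNorm f z ^ (p - 2) *
      (∑ i : Fin n, (Xd i f z * Xd i φ z + Yd i f z * Yd i φ z)) = 0

/-- `Ω` has `C¹` boundary, with Euclidean outward unit normal `ν` on `∂Ω` :
near every boundary point, `Ω` is the sublevel set of a `C¹` defining function
with nonvanishing (Euclidean) gradient, and `ν` is the normalized gradient. -/
def HasC1Boundary (Ω : Set (Heis n)) (ν : Heis n → Heis n) : Prop :=
  ∀ z ∈ frontier Ω, ∃ (V : Set (Heis n)) (g : Heis n → ℝ),
    IsOpen V ∧ z ∈ V ∧ ContDiff ℝ 1 g ∧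
    (∀ w ∈ V, (w ∈ interior Ω ↔ g w < 0)) ∧
    (∀ w ∈ V, (w ∈ frontier Ω ↔ g w = 0)) ∧
    (∀ w ∈ V, w ∈ frontier Ω →
      grad g w ≠ 0 ∧ ν w = (euclNorm (grad g w))⁻¹ • grad g w)

/-- `Ω` (with `C¹` boundary and Euclidean outward unit normal `ν`) is strictly
starshaped with respect to the origin : it contains the origin and `⟨ν, Z⟩ > 0`
everywhere on `∂Ω`. -/
def StrictStarshaped (Ω : Set (Heis n)) (ν : Heis n → Heis n) : Prop :=
  (0 : Heis n) ∈ Ω ∧ HasC1Boundary Ω ν ∧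
    ∀ z ∈ frontier Ω, 0 < einner (ν z) (Zvf z)

/-- `Ω` satisfies the exterior gauge ball property at `z ∈ ∂Ω`, with exterior
tangent gauge ball `B_ρ(z₁, R)`. -/
def ExteriorGaugeBallAt (Ω : Set (Heis n)) (z z₁ : Heis n) (R : ℝ) : Prop :=
  z₁ ∉ closure Ω ∧ gaugeBall z₁ R ⊆ (closure Ω)ᶜ ∧
    closure (gaugeBall z₁ R) ∩ frontier Ω = {z}

/-- `Ω` satisfies a uniform exterior gauge ball property. -/
def UniformExteriorGaugeBall (Ω : Set (Heis n)) : Prop :=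
  ∃ R > 0, ∀ z ∈ frontier Ω, ∃ z₁, ExteriorGaugeBallAt Ω z z₁ R

/-- `Ω` satisfies the interior gauge ball property at `z ∈ ∂Ω`, with interior
tangent gauge ball `B_ρ(z₂, R)`. -/
def InteriorGaugeBallAt (Ω : Set (Heis n)) (z z₂ : Heis n) (R : ℝ) : Prop :=
  z₂ ∈ Ω ∧ gaugeBall z₂ R ⊆ Ω ∧ closure (gaugeBall z₂ R) ∩ frontier Ω = {z}

/-- `Ω` satisfies a uniform interior gauge ball property. -/
def UniformInteriorGaugeBall (Ω : Set (Heis n)) : Prop :=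
  ∃ R > 0, ∀ z ∈ frontier Ω, ∃ z₂, InteriorGaugeBallAt Ω z z₂ R

end Heis

namespace Heis

variable {n : ℕ}

/-- The fourth power of the Koranyi gauge. -/
def gaugePow (v : Heis n) : ℝ :=
  (∑ i : Fin n, (v (xIdx n i) ^ 2 + v (yIdx n i) ^ 2)) ^ 2 + v (tIdx n) ^ 2

lemma rho_lt_iff (v : Heis n) {R : ℝ} (hR : 0 < R) : rho v < R ↔ gaugePow v < R ^ 4 := by
  have hP : 0 ≤ gaugePow v := by unfold gaugePow; positivity
  have hroot : (R ^ 4) ^ ((1 : ℝ) / 4) = R := by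
    rw [← Real.rpow_natCast, ← Real.rpow_mul hR.le]; norm_num
  change gaugePow v ^ ((1 : ℝ) / 4) < R ↔ _
  conv_lhs => rw [← hroot]
  exact Real.rpow_lt_rpow_iff hP (by positivity) (by norm_num)

lemma xIdx_ne (i : Fin n) : (xIdx n i : ℕ) ≠ 2 * n := by
  have := i.isLt; simp only [xIdx]; omega

lemma yIdx_ne (i : Fin n) : (yIdx n i : ℕ) ≠ 2 * n := by
  have := i.isLt; simp only [yIdx]; omega

lemma gaugePow_dil (μ : ℝ) (v : Heis n) :
    gaugePow (dil μ v) = Real.exp μ ^ 4 * gaugePow v := by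
  have h2 : Real.exp (2 * μ) = Real.exp μ ^ 2 := by rw [← Real.exp_nat_mul]; norm_num
  simp only [gaugePow, dil, xIdx_ne, yIdx_ne, if_false, tIdx, if_true, h2, mul_pow,
    ← mul_add, ← Finset.mul_sum]
  ring

lemma mul_inv_mul_inv_self (z v : Heis n) : mul (inv (mul z (inv v))) z = v := by
  funext k
  by_cases hk : (k : ℕ) = 2 * n
  · simp only [mul, inv, hk, if_true, xIdx_ne, yIdx_ne, if_false]
    have : ∑ i : Fin n, (z (xIdx n i) * -(z (yIdx n i) + -v (yIdx n i)) -
        -(z (xIdx n i) + -v (xIdx n i)) * z (yIdx n i)) =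
        ∑ i : Fin n, (-v (xIdx n i) * z (yIdx n i) - z (xIdx n i) * -v (yIdx n i)) :=
      Finset.sum_congr rfl fun i _ => by ring
    rw [this]; ring
  · simp [mul, inv, hk]

lemma mul_inv_inv_mul_self (z w : Heis n) : mul z (inv (mul (inv w) z)) = w := by
  funext k
  by_cases hk : (k : ℕ) = 2 * n
  · simp only [mul, inv, hk, if_true, xIdx_ne, yIdx_ne, if_false]
    have : ∑ i : Fin n, (-(-w (xIdx n i) + z (xIdx n i)) * z (yIdx n i) -
        z (xIdx n i) * -(-w (yIdx n i) + z (yIdx n i))) =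
        ∑ i : Fin n, (z (xIdx n i) * -w (yIdx n i) - -w (xIdx n i) * z (yIdx n i)) :=
      Finset.sum_congr rfl fun i _ => by ring
    rw [this]; ring
  · simp [mul, inv, hk]

lemma dil_zero (z : Heis n) : dil 0 z = z := by
  funext k; simp [dil]

lemma hasDerivAt_dil (z : Heis n) : HasDerivAt (fun μ => dil μ z) (Zvf z) 0 := by
  rw [hasDerivAt_pi]
  intro k
  by_cases hk : (k : ℕ) = 2 * n
  · simp only [dil, Zvf, hk, if_true]
    have := (((hasDerivAt_id (0 : ℝ)).const_mul 2).exp).mul_const (z k)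
    simpa using this
  · simp only [dil, Zvf, hk, if_false]
    simpa using (Real.hasDerivAt_exp 0).mul_const (z k)

lemma differentiable_gaugePow : Differentiable ℝ (gaugePow : Heis n → ℝ) := by
  unfold gaugePow; fun_prop

lemma differentiable_mul_inv_left (z : Heis n) :
    Differentiable ℝ fun w : Heis n => mul (inv w) z := by
  rw [differentiable_pi]
  intro k
  by_cases hk : (k : ℕ) = 2 * n
  · simp only [mul, inv, hk, if_true]; fun_prop
  · simp only [mul, inv, hk, if_false]; fun_prop

lemma differentiable_mul_inv_right (z : Heis n) :
    Differentiable ℝ fun v : Heis n => mul z (inv v) := by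
  rw [differentiable_pi]
  intro k
  by_cases hk : (k : ℕ) = 2 * n
  · simp only [mul, inv, hk, if_true]; fun_prop
  · simp only [mul, inv, hk, if_false]; fun_prop

/-- The fourth power of the gauge distance to `z₁`, as a function of the base point. -/
def gaugeDistPow (z₁ w : Heis n) : ℝ := gaugePow (mul (inv w) z₁)

lemma differentiable_gaugeDistPow (z₁ : Heis n) : Differentiable ℝ (gaugeDistPow z₁) :=
  differentiable_gaugePow.comp (differentiable_mul_inv_left z₁)

lemma mem_gaugeBall_iff (z₁ w : Heis n) {R : ℝ} (hR : 0 < R) :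
    w ∈ gaugeBall z₁ R ↔ gaugeDistPow z₁ w < R ^ 4 :=
  rho_lt_iff _ hR

lemma exists_fderiv_gaugeDistPow_neg (z₁ z : Heis n) (hz : 0 < gaugeDistPow z₁ z) :
    ∃ u, fderiv ℝ (gaugeDistPow z₁) z u < 0 := by
  set v := mul (inv z) z₁ with hv
  let c : ℝ → Heis n := fun μ => mul z₁ (inv (dil μ v))
  have hc0 : c 0 = z := by simp only [c, dil_zero, hv, mul_inv_inv_mul_self]
  have hc : HasDerivAt c (deriv c 0) 0 :=
    (DifferentiableAt.comp (0 : ℝ) (differentiable_mul_inv_right z₁ _)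
      (hasDerivAt_dil v).differentiableAt).hasDerivAt
  have hcomp : HasDerivAt (gaugeDistPow z₁ ∘ c)
      (fderiv ℝ (gaugeDistPow z₁) z (deriv c 0)) 0 := by
    have hF := (differentiable_gaugeDistPow z₁ (c 0)).hasFDerivAt
    have := hF.comp_hasDerivAt (0 : ℝ) hc
    rwa [hc0] at this
  have heq : gaugeDistPow z₁ ∘ c = fun μ => Real.exp μ ^ 4 * gaugeDistPow z₁ z := by
    funext μ
    simp only [Function.comp, c, gaugeDistPow, mul_inv_mul_inv_self, gaugePow_dil, hv]
  have hexp : HasDerivAt (fun μ => Real.exp μ ^ 4 * gaugeDistPow z₁ z)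
      (4 * gaugeDistPow z₁ z) 0 := by
    simpa using ((Real.hasDerivAt_exp 0).pow 4).mul_const (gaugeDistPow z₁ z)
  rw [heq] at hcomp
  refine ⟨-deriv c 0, ?_⟩
  rw [map_neg, hcomp.unique hexp]
  linarith

lemma einner_grad (f : Heis n → ℝ) (z v : Heis n) : einner (grad f z) v = fderiv ℝ f z v := by
  conv_rhs => rw [pi_eq_sum_univ' v, map_sum]
  refine Finset.sum_congr rfl fun k _ => ?_
  simp only [grad, map_smul, smul_eq_mul, mul_comm]

end Heis

/-- A function of one real variable with negative derivative at `0` drops below its value at `0`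
immediately to the right. -/
lemma eventually_lt_of_hasDerivAt_neg {f : ℝ → ℝ} {f' : ℝ} (hf : HasDerivAt f f' 0)
    (hf' : f' < 0) : ∀ᶠ s in nhdsWithin (0 : ℝ) (Ioi 0), f s < f 0 := by
  have h := (hasDerivWithinAt_iff_tendsto_slope' (by simp)).1 (hf.hasDerivWithinAt (s := Ioi 0))
  filter_upwards [h.eventually (gt_mem_nhds hf'), self_mem_nhdsWithin] with s hs hs0
  rw [slope_def_field, sub_zero] at hs
  exact sub_neg.1 (neg_of_div_neg_left hs (le_of_lt hs0))

/-- If `f < f z` forces `0 < g` near a common zero-level point `z`, where `f` is not critical, then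
every direction in which `g` increases is a direction in which `f` decreases. -/
lemma fderiv_neg_of_sublevel {E : Type*} [NormedAddCommGroup E] [NormedSpace ℝ E]
    {f g : E → ℝ} {z u v : E} (hf : DifferentiableAt ℝ f z) (hg : DifferentiableAt ℝ g z)
    (hgz : g z = 0) (h : ∀ᶠ w in nhds z, f w < f z → 0 < g w)
    (hu : fderiv ℝ f z u < 0) (hv : 0 < fderiv ℝ g z v) : fderiv ℝ f z v < 0 := by
  have line : ∀ a : E, HasDerivAt (fun s : ℝ => z + s • a) a 0 := fun a => by
    simpa using ((hasDerivAt_id (0 : ℝ)).smul_const a).const_add z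
  have along : ∀ {φ : E → ℝ}, DifferentiableAt ℝ φ z → ∀ a : E,
      HasDerivAt (fun s : ℝ => φ (z + s • a)) (fderiv ℝ φ z a) 0 := fun {φ} hφ a => by
    have hφ' : HasFDerivAt φ (fderiv ℝ φ z) (z + (0 : ℝ) • a) := by simpa using hφ.hasFDerivAt
    exact hφ'.comp_hasDerivAt (0 : ℝ) (line a)
  have key : ∀ a : E, fderiv ℝ f z a < 0 → 0 ≤ fderiv ℝ g z a := by
    intro a ha
    by_contra! hga
    have hcont : Filter.Tendsto (fun s : ℝ => z + s • a) (nhdsWithin 0 (Ioi 0)) (nhds z) := by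
      have : Filter.Tendsto (fun s : ℝ => z + s • a) (nhds 0) (nhds (z + (0 : ℝ) • a)) :=
        (line a).continuousAt
      rw [zero_smul, add_zero] at this
      exact this.mono_left nhdsWithin_le_nhds
    obtain ⟨s, hs, hfs, hgs⟩ := ((hcont.eventually h).and
      ((eventually_lt_of_hasDerivAt_neg (along hf a) ha).and
        (eventually_lt_of_hasDerivAt_neg (along hg a) hga))).exists
    simp only [zero_smul, add_zero, hgz] at hfs hgs
    exact lt_asymm hgs (hs hfs)
  by_contra! hfv
  set ε := fderiv ℝ g z v / (|fderiv ℝ g z u| + 1) with hε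
  have hpos : 0 < |fderiv ℝ g z u| + 1 := by positivity
  have hε0 : 0 < ε := div_pos hv hpos
  have hεv : ε * (|fderiv ℝ g z u| + 1) = fderiv ℝ g z v := div_mul_cancel₀ _ hpos.ne'
  have := key (ε • u - v) (by
    rw [map_sub, map_smul, smul_eq_mul]
    have := mul_neg_of_pos_of_neg hε0 hu
    linarith)
  rw [map_sub, map_smul, smul_eq_mul] at this
  nlinarith [mul_le_mul_of_nonneg_left (le_abs_self (fderiv ℝ g z u)) hε0.le]

/-- If `Ω` is strictly starshaped and has an exterior tangent
gauge ball `B_ρ(z₁, R)` at `z ∈ ∂Ω`, then the dilations `δ_λ(z)` enter the ball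
for all small `λ > 0`. -/
theorem dil_mem_exterior_gaugeBall
    (n : ℕ) (hn : 1 ≤ n) (Ω : Set (Heis n)) (ν : Heis n → Heis n)
    (hopen : IsOpen Ω) (hbd : Bornology.IsBounded Ω)
    (hstar : Heis.StrictStarshaped Ω ν)
    (z z₁ : Heis n) (R : ℝ) (hR : 0 < R) (hz : z ∈ frontier Ω)
    (hball : Heis.ExteriorGaugeBallAt Ω z z₁ R) :
    ∃ lam > (0 : ℝ), ∀ μ : ℝ, 0 < μ → μ ≤ lam →
      Heis.dil μ z ∈ Heis.gaugeBall z₁ R := by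
  obtain ⟨-, hC1, hν⟩ := hstar
  obtain ⟨V, g, hV, hzV, hg, hint, hfr, hgrad⟩ := hC1 z hz
  obtain ⟨-, hsub, htan⟩ := hball
  have hgdiff : DifferentiableAt ℝ g z := (hg.differentiable (by norm_num)) z
  have hgz : g z = 0 := (hfr z hzV).1 hz
  have hgZ : 0 < fderiv ℝ g z (Heis.Zvf z) := by
    have h := hν z hz
    have hsmul : Heis.einner ((Heis.euclNorm (Heis.grad g z))⁻¹ • Heis.grad g z) (Heis.Zvf z) =
        (Heis.euclNorm (Heis.grad g z))⁻¹ * Heis.einner (Heis.grad g z) (Heis.Zvf z) := by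
      simp only [Heis.einner, Finset.mul_sum, Pi.smul_apply, smul_eq_mul, mul_assoc]
    rw [(hgrad z hzV hz).2, hsmul, Heis.einner_grad] at h
    exact pos_of_mul_pos_right h (inv_nonneg.2 (Real.sqrt_nonneg _))
  have hFdiff := Heis.differentiable_gaugeDistPow z₁
  have hFz : Heis.gaugeDistPow z₁ z = R ^ 4 := by
    apply le_antisymm
    · have hzcl : z ∈ closure (Heis.gaugeBall z₁ R) :=
        (htan.symm ▸ mem_singleton z : z ∈ closure (Heis.gaugeBall z₁ R) ∩ frontier Ω).1
      exact closure_minimal (fun w hw => ((Heis.mem_gaugeBall_iff z₁ w hR).1 hw).le)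
        (isClosed_le hFdiff.continuous continuous_const) hzcl
    · by_contra! hlt
      exact hsub ((Heis.mem_gaugeBall_iff z₁ z hR).2 hlt) hz.1
  have hloc : ∀ᶠ w in nhds z,
      Heis.gaugeDistPow z₁ w < Heis.gaugeDistPow z₁ z → 0 < g w := by
    filter_upwards [hV.mem_nhds hzV] with w hwV hw
    rw [hFz] at hw
    have hwΩ : w ∉ closure Ω := hsub ((Heis.mem_gaugeBall_iff z₁ w hR).2 hw)
    by_contra! hle
    rcases hle.lt_or_eq with hlt | heq
    · exact hwΩ (interior_subset_closure ((hint w hwV).2 hlt))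
    · exact hwΩ ((hfr w hwV).2 heq).1
  obtain ⟨u, hu⟩ := Heis.exists_fderiv_gaugeDistPow_neg z₁ z (by rw [hFz]; positivity)
  have hFZ := fderiv_neg_of_sublevel (hFdiff z) hgdiff hgz hloc hu hgZ
  have hcurve : HasDerivAt (fun μ => Heis.gaugeDistPow z₁ (Heis.dil μ z))
      (fderiv ℝ (Heis.gaugeDistPow z₁) z (Heis.Zvf z)) 0 := by
    have hF : HasFDerivAt (Heis.gaugeDistPow z₁) (fderiv ℝ (Heis.gaugeDistPow z₁) z)
        (Heis.dil 0 z) := by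
      rw [Heis.dil_zero]; exact (hFdiff z).hasFDerivAt
    have h := HasFDerivAt.comp_hasDerivAt (f := fun μ => Heis.dil μ z) (0 : ℝ) hF
      (Heis.hasDerivAt_dil z)
    exact h
  obtain ⟨lam, hlam, hIoc⟩ := mem_nhdsGT_iff_exists_Ioc_subset.1
    (eventually_lt_of_hasDerivAt_neg hcurve hFZ)
  refine ⟨lam, hlam, fun μ hμ hμl => ?_⟩
  have hμ' : Heis.gaugeDistPow z₁ (Heis.dil μ z) < Heis.gaugeDistPow z₁ (Heis.dil 0 z) :=
    hIoc ⟨hμ, hμl⟩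
  rw [Heis.dil_zero, hFz] at hμ'
  exact (Heis.mem_gaugeBall_iff z₁ _ hR).2 hμ'
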